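/- Let ε ∈ (0, σ₀/4) and let x, y be two distinct points lying on the same periodic orbit of the flow (φ_t). If y ∈ 𝒫_ε(x) with y = (u,s)_x, then u ≠ 0 and s ≠ 0. -/

import Mathlib

noncomputable section

open Real

abbrev SL2 : Type := Matrix.SpecialLinearGroup (Fin 2) ℝ
abbrev PSL2 : Type := SL2 ⧸ Subgroup.center SL2

def projSL : SL2 →* PSL2 := QuotientGroup.mk' (Subgroup.center SL2)

def Amat (t : ℝ) : SL2 :=
  ⟨!![Real.exp (t / 2), 0; 0, Real.exp (-(t / 2))], by
    simp [Matrix.det_fin_two_of, ← Real.exp_add]⟩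

def Bmat (t : ℝ) : SL2 :=
  ⟨!![1, t; 0, 1], by simp [Matrix.det_fin_two_of]⟩

def Cmat (t : ℝ) : SL2 :=
  ⟨!![1, 0; t, 1], by simp [Matrix.det_fin_two_of]⟩

def Dmat : SL2 :=
  ⟨!![0, 1; -1, 0], by norm_num [Matrix.det_fin_two_of]⟩

def aflow (t : ℝ) : PSL2 := projSL (Amat t)
def bhor (t : ℝ) : PSL2 := projSL (Bmat t)
def chor (t : ℝ) : PSL2 := projSL (Cmat t)
def dpi : PSL2 := projSL Dmat

abbrev Xq (Γ : Subgroup PSL2) : Type := Quotient (QuotientGroup.rightRel Γ)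

def xmk (Γ : Subgroup PSL2) (g : PSL2) : Xq Γ :=
  Quotient.mk (QuotientGroup.rightRel Γ) g

def flow (Γ : Subgroup PSL2) (t : ℝ) : Xq Γ → Xq Γ :=
  Quotient.lift (fun g => xmk Γ (g * aflow t)) (fun g h hgh => Quot.sound (by
    have h1 : h * g⁻¹ ∈ Γ := QuotientGroup.rightRel_apply.mp hgh
    refine QuotientGroup.rightRel_apply.mpr ?_
    have heq : h * aflow t * (g * aflow t)⁻¹ = h * g⁻¹ := by group
    rw [heq]; exact h1))

def trev (Γ : Subgroup PSL2) : Xq Γ → Xq Γ :=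
  Quotient.lift (fun g => xmk Γ (g * dpi)) (fun g h hgh => Quot.sound (by
    have h1 : h * g⁻¹ ∈ Γ := QuotientGroup.rightRel_apply.mp hgh
    refine QuotientGroup.rightRel_apply.mpr ?_
    have heq : h * dpi * (g * dpi)⁻¹ = h * g⁻¹ := by group
    rw [heq]; exact h1))

def dX (Γ : Subgroup PSL2) (dG : PSL2 → PSL2 → ℝ) (x y : Xq Γ) : ℝ :=
  sInf {r : ℝ | ∃ g h : PSL2, xmk Γ g = x ∧ xmk Γ h = y ∧ dG g h = r}

def Psec (Γ : Subgroup PSL2) (ε : ℝ) (x : Xq Γ) : Set (Xq Γ) :=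
  {y | ∃ (g : PSL2) (u s : ℝ), xmk Γ g = x ∧ |u| < ε ∧ |s| < ε ∧
        y = xmk Γ (g * chor u * bhor s)}

def Psec' (Γ : Subgroup PSL2) (ε : ℝ) (x : Xq Γ) : Set (Xq Γ) :=
  {y | ∃ (g : PSL2) (s u : ℝ), xmk Γ g = x ∧ |s| < ε ∧ |u| < ε ∧
        y = xmk Γ (g * bhor s * chor u)}

def Wsloc (Γ : Subgroup PSL2) (ε : ℝ) (x : Xq Γ) : Set (Xq Γ) :=
  {y | ∃ (g : PSL2) (t : ℝ), xmk Γ g = x ∧ |t| < ε ∧ y = xmk Γ (g * bhor t)}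

def Wuloc (Γ : Subgroup PSL2) (ε : ℝ) (x : Xq Γ) : Set (Xq Γ) :=
  {y | ∃ (g : PSL2) (t : ℝ), xmk Γ g = x ∧ |t| < ε ∧ y = xmk Γ (g * chor t)}

instance : TopologicalSpace SL2 :=
  TopologicalSpace.induced (fun A : SL2 => (A : Matrix (Fin 2) (Fin 2) ℝ)) inferInstance

theorem coe_Amat (t : ℝ) : (Amat t : Matrix (Fin 2) (Fin 2) ℝ) =
    !![Real.exp (t / 2), 0; 0, Real.exp (-(t / 2))] := rfl

theorem coe_Bmat (t : ℝ) : (Bmat t : Matrix (Fin 2) (Fin 2) ℝ) = !![1, t; 0, 1] := rfl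

theorem coe_Cmat (t : ℝ) : (Cmat t : Matrix (Fin 2) (Fin 2) ℝ) = !![1, 0; t, 1] := rfl

theorem xmk_eq_iff (Γ : Subgroup PSL2) (g h : PSL2) :
    xmk Γ g = xmk Γ h ↔ ∃ γ ∈ Γ, h = γ * g := by
  refine Quotient.eq.trans (QuotientGroup.rightRel_apply.trans ⟨fun H => ⟨_, H, by group⟩, ?_⟩)
  rintro ⟨γ, hγ, rfl⟩
  simpa using hγ

theorem aflow_mul (s t : ℝ) : aflow s * aflow t = aflow (s + t) := by
  rw [aflow, aflow, aflow, ← map_mul]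
  congr 1
  ext i j
  fin_cases i <;> fin_cases j <;>
    simp [coe_Amat, Matrix.mul_apply, Fin.sum_univ_two, ← Real.exp_add] <;> ring

theorem aflow_mul_neg (t : ℝ) : aflow t * aflow (-t) = 1 := by
  rw [aflow_mul, add_neg_cancel, aflow, show Amat 0 = 1 from ?_, map_one]
  ext i j
  fin_cases i <;> fin_cases j <;> simp [coe_Amat]

theorem bhor_mul (s t : ℝ) : bhor s * bhor t = bhor (s + t) := by
  rw [bhor, bhor, bhor, ← map_mul]
  congr 1
  ext i j
  fin_cases i <;> fin_cases j <;> simp [coe_Bmat, Matrix.mul_apply, Fin.sum_univ_two, add_comm]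

theorem chor_mul (s t : ℝ) : chor s * chor t = chor (s + t) := by
  rw [chor, chor, chor, ← map_mul]
  congr 1
  ext i j
  fin_cases i <;> fin_cases j <;> simp [coe_Cmat, Matrix.mul_apply, Fin.sum_univ_two]

theorem bhor_zero : bhor 0 = 1 := by
  rw [bhor, show Bmat 0 = 1 from ?_, map_one]
  ext i j
  fin_cases i <;> fin_cases j <;> simp [coe_Bmat]

theorem chor_zero : chor 0 = 1 := by
  rw [chor, show Cmat 0 = 1 from ?_, map_one]
  ext i j
  fin_cases i <;> fin_cases j <;> simp [coe_Cmat]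

theorem bhor_mul_aflow (s t : ℝ) :
    bhor s * aflow t = aflow t * bhor (Real.exp (-t) * s) := by
  rw [bhor, bhor, aflow, ← map_mul, ← map_mul]
  congr 1
  have h : Real.exp (-(t / 2)) = Real.exp (t / 2) * Real.exp (-t) := by
    rw [← Real.exp_add]; ring_nf
  ext i j
  fin_cases i <;> fin_cases j <;> simp [coe_Amat, coe_Bmat, Matrix.mul_apply, Fin.sum_univ_two]
  rw [h]; ring

theorem chor_mul_aflow (u t : ℝ) :
    chor u * aflow t = aflow t * chor (Real.exp t * u) := by
  rw [chor, chor, aflow, ← map_mul, ← map_mul]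
  congr 1
  have h : Real.exp (t / 2) = Real.exp (-(t / 2)) * Real.exp t := by
    rw [← Real.exp_add]; ring_nf
  ext i j
  fin_cases i <;> fin_cases j <;> simp [coe_Amat, coe_Cmat, Matrix.mul_apply, Fin.sum_univ_two]
  rw [h]; ring

theorem eq_zero_of_bhor_eq_one {s : ℝ} (h : bhor s = 1) : s = 0 := by
  have hc := Subgroup.mem_center_iff.mp ((QuotientGroup.eq_one_iff _).mp h) (Cmat 1)
  have h00 := congrArg (fun M : SL2 => (M : Matrix (Fin 2) (Fin 2) ℝ) 0 0) hc
  simpa [coe_Bmat, coe_Cmat, Matrix.mul_apply, Fin.sum_univ_two] using h00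

theorem eq_zero_of_chor_eq_one {u : ℝ} (h : chor u = 1) : u = 0 := by
  have hc := Subgroup.mem_center_iff.mp ((QuotientGroup.eq_one_iff _).mp h) (Bmat 1)
  have h00 := congrArg (fun M : SL2 => (M : Matrix (Fin 2) (Fin 2) ℝ) 0 0) hc
  simpa [coe_Bmat, coe_Cmat, Matrix.mul_apply, Fin.sum_univ_two] using h00

/-- If `Γ g` is fixed by `a` and `Γ g w` is a translate of `Γ g` by an element `α` commuting
with `a`, then conjugating `w` by `a` does not change the point `Γ g w`. -/
theorem exists_mem_mul_eq_of_commute {Γ : Subgroup PSL2} {g a α w w' γ δ : PSL2}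
    (hγ : γ ∈ Γ) (hδ : δ ∈ Γ) (hga : g * a = γ * g) (hgw : g * w = δ * (g * α))
    (hcomm : α * a = a * α) (hw : w * a = a * w') : ∃ η ∈ Γ, g * w' = η * (g * w) := by
  refine ⟨γ⁻¹ * δ * γ * δ⁻¹,
    Γ.mul_mem (Γ.mul_mem (Γ.mul_mem (Γ.inv_mem hγ) hδ) hγ) (Γ.inv_mem hδ), ?_⟩
  have h : γ * (g * w') = δ * γ * (g * α) := by
    calc γ * (g * w') = g * a * w' := by rw [hga]; group
      _ = g * w * a := by rw [mul_assoc, ← hw, mul_assoc]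
      _ = δ * g * (α * a) := by rw [hgw]; group
      _ = δ * (g * a) * α := by rw [hcomm]; group
      _ = δ * γ * (g * α) := by rw [hga]; group
  rw [hgw, eq_inv_mul_of_mul_eq h]
  group

/-- A one-parameter horocyclic subgroup `f`, contracted by the flow over a period of `Γ g`,
meets the orbit of `Γ g` near `Γ g` only at parameter `0`. -/
theorem eq_zero_of_contracted {dG : PSL2 → PSL2 → ℝ}
    (hdG_left : ∀ k g h : PSL2, dG (k * g) (k * h) = dG g h)
    {Γ : Subgroup PSL2} {σ₀ : ℝ}
    (hΓ : ∀ g γ : PSL2, γ ∈ Γ → γ ≠ 1 → σ₀ ≤ dG g (γ * g))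
    {f : ℝ → PSL2} (hf_mul : ∀ s t, f s * f t = f (s + t)) (hf_one : ∀ s, f s = 1 → s = 0)
    (hf_dist : ∀ s, dG (f s) 1 ≤ |s|)
    {g γ : PSL2} {r t τ q : ℝ} (hγ : γ ∈ Γ) (hga : g * aflow τ = γ * g)
    (horb : xmk Γ (g * aflow t) = xmk Γ (g * f r))
    (hf_flow : f r * aflow τ = aflow τ * f (q * r)) (hq0 : 0 < q) (hq1 : q < 1)
    (hr : |r| < σ₀) : r = 0 := by
  obtain ⟨δ, hδ, hgw⟩ := (xmk_eq_iff _ _ _).mp horb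
  obtain ⟨η, hη, h⟩ := exists_mem_mul_eq_of_commute hγ hδ hga hgw
    (by rw [aflow_mul, aflow_mul, add_comm]) hf_flow
  have hsplit : f (q * r) * f ((1 - q) * r) = f r := by
    rw [hf_mul]; ring_nf
  have hη1 : η = 1 := by
    by_contra hne
    have h1 := hΓ (g * f r) η hη hne
    have h2 : dG (f r) (f (q * r)) = dG (f ((1 - q) * r)) 1 := by
      rw [← hdG_left (f (q * r)) (f ((1 - q) * r)) 1, hsplit, mul_one]
    rw [← h, hdG_left, h2] at h1
    have h3 := hf_dist ((1 - q) * r)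
    rw [abs_mul, abs_of_pos (sub_pos.mpr hq1)] at h3
    nlinarith [abs_nonneg r]
  rw [hη1, one_mul] at h
  rw [mul_left_cancel h, mul_eq_left] at hsplit
  have hz := hf_one _ hsplit
  exact (mul_eq_zero.mp hz).resolve_left (sub_pos.mpr hq1).ne'

theorem stmt_18
    (dG : PSL2 → PSL2 → ℝ)
    (hdG_self : ∀ g : PSL2, dG g g = 0)
    (hdG_sep : ∀ g h : PSL2, dG g h = 0 → g = h)
    (hdG_symm : ∀ g h : PSL2, dG g h = dG h g)
    (hdG_tri : ∀ g h k : PSL2, dG g k ≤ dG g h + dG h k)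
    (hdG_left : ∀ k g h : PSL2, dG (k * g) (k * h) = dG g h)
    (hdG_b : ∀ s : ℝ, dG (bhor s) 1 ≤ |s|)
    (hdG_c : ∀ u : ℝ, dG (chor u) 1 ≤ |u|)
    (hdG_a : ∀ τ : ℝ, dG (aflow τ) 1 ≤ |τ| / Real.sqrt 2)
    (Γ : Subgroup PSL2) (σ₀ : ℝ) (hσ₀ : 0 < σ₀)
    (hΓ : ∀ (g γ : PSL2), γ ∈ Γ → γ ≠ 1 → σ₀ ≤ dG g (γ * g))
    (ε : ℝ) (hε0 : 0 < ε) (hε : ε < σ₀ / 4)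
    (g : PSL2) (u s T : ℝ) (hT : 0 < T)
    (hper : flow Γ T (xmk Γ g) = xmk Γ g)
    (horb : xmk Γ (g * chor u * bhor s) ∈ Set.range (fun t : ℝ => flow Γ t (xmk Γ g)))
    (hne : xmk Γ (g * chor u * bhor s) ≠ xmk Γ g)
    (hu : |u| < ε) (hs : |s| < ε) :
    u ≠ 0 ∧ s ≠ 0 := by
  obtain ⟨t, ht⟩ := horb
  obtain ⟨γ, hγ, hga⟩ := (xmk_eq_iff _ _ _).mp hper.symm
  change xmk Γ (g * aflow t) = _ at ht
  have hr {r : ℝ} (h : |r| < ε) : |r| < σ₀ := by linarith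
  refine ⟨fun hu0 => hne ?_, fun hs0 => hne ?_⟩
  · rw [hu0, chor_zero, mul_one] at ht ⊢
    rw [eq_zero_of_contracted hdG_left hΓ bhor_mul (fun _ => eq_zero_of_bhor_eq_one) hdG_b hγ hga
      ht (bhor_mul_aflow s T) (Real.exp_pos _) (Real.exp_lt_one_iff.mpr (by linarith)) (hr hs),
      bhor_zero, mul_one]
  · rw [hs0, bhor_zero, mul_one] at ht ⊢
    have hga' : g * aflow (-T) = γ⁻¹ * g := by
      rw [eq_inv_mul_iff_mul_eq, ← mul_assoc, ← hga, mul_assoc, aflow_mul_neg, mul_one]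
    rw [eq_zero_of_contracted hdG_left hΓ chor_mul (fun _ => eq_zero_of_chor_eq_one) hdG_c
      (Γ.inv_mem hγ) hga' ht (chor_mul_aflow u (-T)) (Real.exp_pos _)
      (Real.exp_lt_one_iff.mpr (by linarith)) (hr hu), chor_zero, mul_one]
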